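/- (Lemma 5.14) Assume hypotheses (H₀) with A = ∂Φ₂ (writing Φ₁ for Φ) and (λ_n L_{Φ₁}) ∈ ℓ², and assume moreover that either (i) liminf_n λ_nβ_n > 0, the sequence (λ_n) is bounded and β_{n+1} − β_n ≤ Kλ_{n+1}β_{n+1} for some K > 0 and all n, or (ii) Ψ₁ = Ψ₂ = 0. If a subsequence (x_{n_k}) of the sequence (x_n) generated by the algorithm converges weakly to some x_∞ ∈ H, then x_∞ ∈ S = argmin{Φ₁(x) + Φ₂(x) : x ∈ argmin(Ψ₁ + Ψ₂)}. -/

import Mathlib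

open Filter Topology
open scoped RealInnerProductSpace

variable {H : Type*} [NormedAddCommGroup H] [InnerProductSpace ℝ H] [CompleteSpace H]

/-- A set-valued operator `A : H → Set H` is monotone. -/
def MonotoneOp (A : H → Set H) : Prop :=
  ∀ x y x' y', x' ∈ A x → y' ∈ A y → 0 ≤ ⟪x' - y', x - y⟫

/-- A set-valued operator is maximal monotone: it is monotone and its graph is not
properly contained in the graph of any other monotone operator. -/
def MaxMonotoneOp (A : H → Set H) : Prop :=
  MonotoneOp A ∧ ∀ B : H → Set H, MonotoneOp B → (∀ x, A x ⊆ B x) → B = A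

/-- The (outward) normal cone to a set `C` at `x`: empty when `x ∉ C`. -/
def nCone (C : Set H) (x : H) : Set H :=
  {p | x ∈ C ∧ ∀ c ∈ C, ⟪p, c - x⟫ ≤ 0}

/-- Subdifferential of an extended-real-valued function. -/
def ESubdiff (F : H → EReal) (x : H) : Set H :=
  {p | ∀ y, F x + ((⟪p, y - x⟫ : ℝ) : EReal) ≤ F y}

/-- Fenchel conjugate of an extended-real-valued function. -/
noncomputable def fenchelConj (F : H → EReal) (p : H) : EReal :=
  ⨆ y, (((⟪y, p⟫ : ℝ) : EReal) - F y)

/-- Support function of a set. -/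
noncomputable def suppFun (C : Set H) (p : H) : EReal :=
  ⨆ c : C, ((⟪p, (c : H)⟫ : ℝ) : EReal)

/-- `F : H → EReal` is proper (not identically `+∞`, never `−∞`),
lower-semicontinuous and convex. -/
def ProperLscConvexE (F : H → EReal) : Prop :=
  (∃ x, F x ≠ ⊤) ∧ (∀ x, F x ≠ ⊥) ∧ LowerSemicontinuous F ∧
    ∀ x y (t : ℝ), 0 ≤ t → t ≤ 1 →
      F (t • x + (1 - t) • y) ≤ ((t : ℝ) : EReal) * F x + (((1 - t : ℝ)) : EReal) * F y

/-- Weak convergence of a sequence in a Hilbert space. -/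
def WeakConv (x : ℕ → H) (p : H) : Prop :=
  ∀ y : H, Tendsto (fun n => ⟪x n, y⟫) atTop (𝓝 ⟪p, y⟫)

/-- A weak cluster point: weak limit of some subsequence. -/
def WeakClusterPt (x : ℕ → H) (p : H) : Prop :=
  ∃ φ : ℕ → ℕ, StrictMono φ ∧ WeakConv (x ∘ φ) p

/-- Boundedly inf-compact function: intersections of balls and sublevel sets are
relatively compact. -/
def BddInfCompact (F : H → EReal) : Prop :=
  ∀ R M : ℝ, 0 ≤ R → IsCompact (closure {p : H | ‖p‖ ≤ R ∧ F p ≤ (M : EReal)})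

/-- The data of the (SFBP) algorithm together with hypotheses (H₀). -/
structure SFBP (H : Type*) [NormedAddCommGroup H] [InnerProductSpace ℝ H]
    [CompleteSpace H] where
  /-- the maximal monotone operator -/
  A : H → Set H
  /-- the smooth potential -/
  Φ : H → ℝ
  /-- its gradient -/
  Φ' : H → H
  /-- the smooth penalization potential -/
  Ψ₁ : H → ℝ
  /-- its gradient -/
  Ψ₁' : H → H
  /-- the nonsmooth penalization potential -/
  Ψ₂ : H → EReal
  /-- the constraint set -/
  C : Set H
  /-- the step sizes -/
  lam : ℕ → ℝ
  /-- the penalization parameters -/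
  beta : ℕ → ℝ
  /-- Lipschitz constant of ∇Φ -/
  LΦ : ℝ
  /-- Lipschitz constant of ∇Ψ₁ -/
  LΨ₁ : ℝ
  /-- the sequence generated by the algorithm -/
  x : ℕ → H
  convΦ : ConvexOn ℝ Set.univ Φ
  gradΦ : ∀ p, HasGradientAt Φ (Φ' p) p
  lipΦ : ∀ p q, ‖Φ' p - Φ' q‖ ≤ LΦ * ‖p - q‖
  convΨ₁ : ConvexOn ℝ Set.univ Ψ₁
  gradΨ₁ : ∀ p, HasGradientAt Ψ₁ (Ψ₁' p) p
  lipΨ₁ : ∀ p q, ‖Ψ₁' p - Ψ₁' q‖ ≤ LΨ₁ * ‖p - q‖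
  properΨ₂ : ProperLscConvexE Ψ₂
  Ψ₁nonneg : ∀ p, 0 ≤ Ψ₁ p
  Ψ₂nonneg : ∀ p, (0 : EReal) ≤ Ψ₂ p
  minΨ₁ : ∃ p, Ψ₁ p = 0
  minΨ₂ : ∃ p, Ψ₂ p = 0
  Cdef : C = {p | ∀ q, Ψ₁ p ≤ Ψ₁ q} ∩ {p | ∀ q, Ψ₂ p ≤ Ψ₂ q}
  Cne : C.Nonempty
  maxmonA : MaxMonotoneOp A
  maxmonT : MaxMonotoneOp
    (fun p => {w | ∃ za ∈ A p, ∃ v ∈ nCone C p, w = za + Φ' p + v})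
  Sne : ∃ p, ∃ za ∈ A p, ∃ v ∈ nCone C p, za + Φ' p + v = 0
  lamPos : ∀ n, 0 < lam n
  betaPos : ∀ n, 0 < beta n
  lamDiv : Tendsto (fun N => ∑ k ∈ Finset.range N, lam k) atTop atTop
  sumSq : Summable fun n => LΦ * lam n ^ 2
  limsupCond : ∃ γ : ℝ, γ < 2 ∧ ∀ᶠ n in atTop, LΨ₁ * (lam n * beta n) ≤ γ
  keyCond : ∀ z : H, (∃ u, z ∈ nCone C u) →
    ∃ M : ℝ, ∀ N : ℕ, ∑ n ∈ Finset.range N,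
      (((lam n * beta n : ℝ)) : EReal) *
        (fenchelConj (fun q => ((Ψ₁ q : ℝ) : EReal) + Ψ₂ q) ((beta n)⁻¹ • z)
          - suppFun C ((beta n)⁻¹ • z)) ≤ (M : EReal)
  algo : ∀ n, ∃ a ∈ A (x (n + 1)), ∃ w ∈ ESubdiff Ψ₂ (x (n + 1)),
    x n - x (n + 1) = lam n • (Φ' (x n) + beta n • Ψ₁' (x n) + a + beta n • w)

/-- The solution set `S = (A + ∇Φ + N_C)⁻¹(0)`. -/
def SFBP.S (d : SFBP H) : Set H :=
  {p | ∃ za ∈ d.A p, ∃ v ∈ nCone d.C p, za + d.Φ' p + v = 0}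

/-! ### Helper lemmas -/

/-- Gradient inequality for convex functions. -/
lemma aux_grad_ineq {f : H → ℝ} {f' : H → H} (hc : ConvexOn ℝ Set.univ f)
    (hg : ∀ p, HasGradientAt f (f' p) p) (x y : H) : f x + ⟪f' x, y - x⟫ ≤ f y := by
  have hline : HasDerivAt (fun t : ℝ => f (x + t • (y - x))) ⟪f' x, y - x⟫ 0 := by
    have h1 : HasFDerivAt f (InnerProductSpace.toDual ℝ H (f' x)) (x + (0:ℝ) • (y - x)) := by
      simpa using (hg x).hasFDerivAt
    have h2 : HasDerivAt (fun t : ℝ => x + t • (y - x)) (y - x) 0 := by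
      simpa using ((hasDerivAt_id (0:ℝ)).smul_const (y - x)).const_add x
    exact h1.comp_hasDerivAt (0:ℝ) h2
  have hcv : ConvexOn ℝ Set.univ (fun t : ℝ => f (x + t • (y - x))) := by
    refine ⟨convex_univ, fun s _ t _ a b ha hb hab => ?_⟩
    have := hc.2 (Set.mem_univ (x + s • (y - x))) (Set.mem_univ (x + t • (y - x))) ha hb hab
    have e : x + (a • s + b • t) • (y - x) = a • (x + s • (y - x)) + b • (x + t • (y - x)) := by
      have : x = (a + b) • x := by rw [hab, one_smul]
      nth_rewrite 1 [this]
      simp only [smul_eq_mul]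
      module
    show f _ ≤ _
    rw [e]
    exact this
  have := hcv.le_slope_of_hasDerivAt (Set.mem_univ 0) (Set.mem_univ 1) one_pos hline
  simp [slope_def_field] at this
  linarith

/-- Descent lemma. -/
lemma aux_descent {f : H → ℝ} {f' : H → H} {L : ℝ}
    (hg : ∀ p, HasGradientAt f (f' p) p) (hL : ∀ p q, ‖f' p - f' q‖ ≤ L * ‖p - q‖) (x y : H) :
    f y ≤ f x + ⟪f' x, y - x⟫ + L / 2 * ‖y - x‖ ^ 2 := by
  have hline : ∀ t : ℝ, HasDerivAt (fun t : ℝ => f (x + t • (y - x)))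
      ⟪f' (x + t • (y - x)), y - x⟫ t := by
    intro t
    have h1 := (hg (x + t • (y - x))).hasFDerivAt
    have h2 : HasDerivAt (fun t : ℝ => x + t • (y - x)) (y - x) t := by
      simpa using ((hasDerivAt_id t).smul_const (y - x)).const_add x
    exact h1.comp_hasDerivAt t h2
  have hG : ∀ t : ℝ, HasDerivAt (fun t : ℝ => f (x + t • (y - x)) - t * ⟪f' x, y - x⟫
      - t ^ 2 * (L / 2 * ‖y - x‖ ^ 2))
      (⟪f' (x + t • (y - x)), y - x⟫ - ⟪f' x, y - x⟫ - 2 * t * (L / 2 * ‖y - x‖ ^ 2)) t := by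
    intro t
    have h3 := ((hline t).sub ((hasDerivAt_id t).mul_const ⟪f' x, y - x⟫)).sub
      ((hasDerivAt_pow 2 t).mul_const (L / 2 * ‖y - x‖ ^ 2))
    refine h3.congr_deriv ?_
    simp
  have hanti : AntitoneOn (fun t : ℝ => f (x + t • (y - x)) - t * ⟪f' x, y - x⟫
      - t ^ 2 * (L / 2 * ‖y - x‖ ^ 2)) (Set.Icc 0 1) := by
    apply antitoneOn_of_deriv_nonpos (convex_Icc 0 1)
      (fun t _ => (hG t).continuousAt.continuousWithinAt)
      (fun t _ => (hG t).differentiableAt.differentiableWithinAt)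
    intro t ht
    rw [interior_Icc] at ht
    rw [(hG t).deriv, ← inner_sub_left]
    have h1 := real_inner_le_norm (f' (x + t • (y - x)) - f' x) (y - x)
    have h2 := hL (x + t • (y - x)) x
    rw [add_sub_cancel_left, norm_smul, Real.norm_of_nonneg ht.1.le] at h2
    have h3 := mul_le_mul_of_nonneg_right h2 (norm_nonneg (y - x))
    nlinarith
  have := hanti (Set.left_mem_Icc.2 zero_le_one) (Set.right_mem_Icc.2 zero_le_one) zero_le_one
  simp at this
  linarith

/-- Consequence of cocoercivity. -/
lemma aux_coco {f : H → ℝ} {f' : H → H} {L τ γ : ℝ} (hc : ConvexOn ℝ Set.univ f)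
    (hg : ∀ p, HasGradientAt f (f' p) p) (hL : ∀ p q, ‖f' p - f' q‖ ≤ L * ‖p - q‖)
    (hf0 : ∀ p, 0 ≤ f p) {u : H} (hu : f u = 0) (hτ : 0 < τ) (hγ : 0 < γ) (hτL : L * τ ≤ γ)
    (x z : H) : -(γ / 2) * ‖z - x‖ ^ 2 ≤ 2 * τ * ⟪f' x, z - u⟫ := by
  have hu' : f' u = 0 := by
    have hmin : IsLocalMin f u := Filter.Eventually.of_forall (fun p => by rw [hu]; exact hf0 p)
    have := hmin.hasFDerivAt_eq_zero (hg u).hasFDerivAt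
    simpa using this
  set g := f' x with hgdef
  set t := τ / γ with ht
  have htτ : γ * t = τ := by rw [ht]; field_simp
  have htp : 0 < t := by positivity
  have a1 := aux_grad_ineq hc hg x (u + t • g)
  have a2 := aux_descent hg hL u (u + t • g)
  have a3 := aux_descent hg hL x (x - t • g)
  have a4 := hf0 (x - t • g)
  have e1 : ⟪f' x, u + t • g - x⟫ = t * ‖g‖ ^ 2 + ⟪g, u - x⟫ := by
    rw [show u + t • g - x = t • g + (u - x) by abel, inner_add_right, inner_smul_right, ← hgdef,
      real_inner_self_eq_norm_sq]
  have e2 : ‖u + t • g - u‖ ^ 2 = t ^ 2 * ‖g‖ ^ 2 := by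
    rw [add_sub_cancel_left, norm_smul, mul_pow, Real.norm_eq_abs, sq_abs]
  have e3 : ⟪f' x, x - t • g - x⟫ = - (t * ‖g‖ ^ 2) := by
    rw [show x - t • g - x = -(t • g) by abel, inner_neg_right, inner_smul_right, ← hgdef,
      real_inner_self_eq_norm_sq]
  have e4 : ‖x - t • g - x‖ ^ 2 = t ^ 2 * ‖g‖ ^ 2 := by
    rw [show x - t • g - x = -(t • g) by abel, norm_neg, norm_smul, mul_pow, Real.norm_eq_abs,
      sq_abs]
  rw [e1] at a1
  rw [hu, hu', inner_zero_left, e2] at a2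
  rw [e3, e4] at a3
  have e5 : ⟪g, z - u⟫ = ⟪g, z - x⟫ - ⟪g, u - x⟫ := by
    rw [← inner_sub_right]; congr 1; abel
  have a5 : -(‖g‖ * ‖z - x‖) ≤ ⟪g, z - x⟫ := by
    have := abs_le.1 (abs_real_inner_le_norm g (z - x))
    exact this.1
  have a6 : (2 * t - L * t ^ 2) * ‖g‖ ^ 2 ≤ - ⟪g, u - x⟫ := by nlinarith
  have a7 : t ≤ 2 * t - L * t ^ 2 := by
    have : L * t ≤ 1 := by
      rw [ht, ← mul_div_assoc, div_le_one hγ]; exact hτL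
    nlinarith
  have a8 : t * ‖g‖ ^ 2 ≤ - ⟪g, u - x⟫ :=
    le_trans (mul_le_mul_of_nonneg_right a7 (sq_nonneg _)) a6
  rw [e5]
  have a9 : t * ‖g‖ ^ 2 - ‖g‖ * ‖z - x‖ ≤ ⟪g, z - x⟫ - ⟪g, u - x⟫ := by linarith
  have a10 := mul_le_mul_of_nonneg_left a9 (by positivity : 0 ≤ 2 * τ)
  refine le_trans ?_ a10
  rw [← htτ]
  have : 0 ≤ γ / 2 * (2 * t * ‖g‖ - ‖z - x‖) ^ 2 := by positivity
  nlinarith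

/-- Discrete Gronwall-type lemma. -/
lemma aux_gronwall {lam P r : ℕ → ℝ} {K : ℝ} (hK : 0 < K) (hlam : ∀ n, 0 < lam n)
    (hdiv : Tendsto (fun N => ∑ k ∈ Finset.range N, lam k) atTop atTop)
    (hP : ∀ n, 0 ≤ P n) (hr : ∀ n, 0 ≤ r n)
    (hsP : Summable fun n => lam n * P n) (hsr : Summable fun n => lam n * r n)
    (hrec : ∀ᶠ n in atTop, 2 * K * lam (n + 1) ≤ 1 →
      P (n + 1) ≤ (1 + 4 * K * lam (n + 1)) * P n + K * lam (n + 1) * r (n + 1)) :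
    Tendsto P atTop (𝓝 0) := by
  have key : ∀ δ > 0, ∀ᶠ n in atTop, P n ≤ Real.exp 2 * (2 * δ) := by
    intro δ hδ
    set η := δ / (2 * K) with hη
    have hηp : 0 < η := by positivity
    obtain ⟨N1, hN1⟩ := eventually_atTop.1 hrec
    have hc1 := (summable_iff_cauchySeq_finset.1 hsP)
    obtain ⟨s1, hs1⟩ := (summable_iff_vanishing_norm.1 hsP) η hηp
    obtain ⟨s2, hs2⟩ := (summable_iff_vanishing_norm.1 hsr) η hηp
    obtain ⟨N2, hN2⟩ := (s1 ∪ s2).bddAbove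
    set N := max N1 (N2 + 1) with hN
    have hdisj : ∀ s ⊆ s1 ∪ s2, ∀ a b, N ≤ a → Disjoint (Finset.Ioc a b) s := by
      intro s hs a b ha
      rw [Finset.disjoint_left]
      intro j hj hjs
      have h1 : j ≤ N2 := hN2 (by exact_mod_cast hs hjs)
      have h2 := (Finset.mem_Ioc.1 hj).1
      have : N2 + 1 ≤ N := le_max_right _ _
      omega
    have hT : ∀ a b, N ≤ a → ∑ j ∈ Finset.Ioc a b, lam j * P j ≤ η := by
      intro a b ha
      have := hs1 (Finset.Ioc a b) (hdisj s1 Finset.subset_union_left a b ha)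
      exact le_trans (le_abs_self _) this.le
    have hV : ∀ a b, N ≤ a → ∑ j ∈ Finset.Ioc a b, lam j * r j ≤ η := by
      intro a b ha
      have := hs2 (Finset.Ioc a b) (hdisj s2 Finset.subset_union_right a b ha)
      exact le_trans (le_abs_self _) this.le
    -- a good index
    obtain ⟨k, hkN, hk⟩ : ∃ k, N ≤ k ∧ P k < δ := by
      by_contra hcon
      push Not at hcon
      have hsl : Summable lam := by
        refine Summable.of_norm_bounded_eventually_nat (g := fun n => lam n * P n * δ⁻¹)
          (hsP.mul_right _) ?_
        filter_upwards [eventually_ge_atTop N] with n hn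
        rw [Real.norm_of_nonneg (hlam n).le, ← div_eq_mul_inv, le_div_iff₀ hδ]
        exact mul_le_mul_of_nonneg_left (hcon n hn) (hlam n).le
      exact not_tendsto_nhds_of_tendsto_atTop hdiv _ hsl.hasSum.tendsto_sum_nat
    have hind : ∀ n, k ≤ n → P n ≤ Real.exp (4 * K / δ * ∑ j ∈ Finset.Ioc k n, lam j * P j) *
        (δ + K * ∑ j ∈ Finset.Ioc k n, lam j * r j) := by
      intro n hn
      induction n, hn using Nat.le_induction with
      | base => simp; exact hk.le
      | succ n hn ih =>
        have hT0 : ∀ m, 0 ≤ ∑ j ∈ Finset.Ioc k m, lam j * P j := fun m =>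
          Finset.sum_nonneg (fun j _ => mul_nonneg (hlam j).le (hP j))
        have hV0 : ∀ m, 0 ≤ ∑ j ∈ Finset.Ioc k m, lam j * r j := fun m =>
          Finset.sum_nonneg (fun j _ => mul_nonneg (hlam j).le (hr j))
        have hexp1 : ∀ m, 1 ≤ Real.exp (4 * K / δ * ∑ j ∈ Finset.Ioc k m, lam j * P j) :=
          fun m => Real.one_le_exp (mul_nonneg (by positivity) (hT0 m))
        by_cases hcase : P (n + 1) < δ
        · have h1 := hexp1 (n + 1)
          have h2 := hV0 (n + 1)
          have h3 : 0 ≤ K * ∑ j ∈ Finset.Ioc k (n+1), lam j * r j := by positivity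
          nlinarith
        · push Not at hcase
          have hsT : ∑ j ∈ Finset.Ioc k (n + 1), lam j * P j =
              ∑ j ∈ Finset.Ioc k n, lam j * P j + lam (n + 1) * P (n + 1) :=
            Finset.sum_Ioc_succ_top hn _
          have hsV : ∑ j ∈ Finset.Ioc k (n + 1), lam j * r j =
              ∑ j ∈ Finset.Ioc k n, lam j * r j + lam (n + 1) * r (n + 1) :=
            Finset.sum_Ioc_succ_top hn _
          have hl1 : lam (n + 1) * δ ≤ lam (n + 1) * P (n + 1) :=
            mul_le_mul_of_nonneg_left hcase (hlam _).le
          have hl2 : lam (n + 1) * P (n + 1) ≤ η := by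
            have := hT k (n + 1) hkN
            have := hT0 n
            linarith
          have hl3 : 2 * K * lam (n + 1) ≤ 1 := by
            have : lam (n + 1) * δ ≤ δ / (2 * K) := by linarith
            rw [le_div_iff₀ (by positivity)] at this
            nlinarith
          have hR := hN1 n (le_trans (le_max_left _ _) (le_trans hkN hn)) hl3
          have hfac : 1 + 4 * K * lam (n + 1) ≤
              Real.exp (4 * K / δ * (lam (n + 1) * P (n + 1))) := by
            have h1 : 4 * K * lam (n + 1) ≤ 4 * K / δ * (lam (n + 1) * P (n + 1)) := by
              have : 4 * K * lam (n + 1) = 4 * K / δ * (lam (n + 1) * δ) := by field_simp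
              rw [this]
              exact mul_le_mul_of_nonneg_left hl1 (by positivity)
            have h2 := Real.add_one_le_exp (4 * K / δ * (lam (n + 1) * P (n + 1)))
            linarith
          rw [hsV]
          have hexpS : Real.exp (4 * K / δ * ∑ j ∈ Finset.Ioc k (n+1), lam j * P j) =
            Real.exp (4 * K / δ * (lam (n + 1) * P (n + 1))) *
              Real.exp (4 * K / δ * ∑ j ∈ Finset.Ioc k n, lam j * P j) := by
            rw [← Real.exp_add, hsT]; congr 1; ring
          have h5 := hexp1 (n + 1)
          have h6 : 0 ≤ K * (lam (n + 1) * r (n + 1)) :=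
            mul_nonneg hK.le (mul_nonneg (hlam _).le (hr _))
          have h7 : (1 + 4 * K * lam (n + 1)) * P n ≤
              Real.exp (4 * K / δ * (lam (n + 1) * P (n + 1))) *
              (Real.exp (4 * K / δ * ∑ j ∈ Finset.Ioc k n, lam j * P j) *
                (δ + K * ∑ j ∈ Finset.Ioc k n, lam j * r j)) :=
            mul_le_mul hfac ih (hP n) (Real.exp_pos _).le
          rw [← mul_assoc, ← hexpS] at h7
          nlinarith
    filter_upwards [eventually_ge_atTop k] with n hn
    refine le_trans (hind n hn) ?_
    have hT' := hT k n hkN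
    have hV' := hV k n hkN
    have b1 : 4 * K / δ * ∑ j ∈ Finset.Ioc k n, lam j * P j ≤ 2 := by
      calc _ ≤ 4 * K / δ * η := mul_le_mul_of_nonneg_left hT' (by positivity)
        _ = 2 := by rw [hη]; field_simp; norm_num
    have b2 : δ + K * ∑ j ∈ Finset.Ioc k n, lam j * r j ≤ 2 * δ := by
      have : K * ∑ j ∈ Finset.Ioc k n, lam j * r j ≤ K * η :=
        mul_le_mul_of_nonneg_left hV' hK.le
      have h : K * η = δ / 2 := by rw [hη]; field_simp
      linarith
    have b3 : 0 ≤ ∑ j ∈ Finset.Ioc k n, lam j * r j :=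
          Finset.sum_nonneg (fun j _ => mul_nonneg (hlam j).le (hr j))
    exact mul_le_mul (Real.exp_le_exp.2 b1) b2 (by positivity) (Real.exp_pos _).le
  rw [Metric.tendsto_nhds]
  intro ε hε
  have hE := Real.exp_pos 2
  filter_upwards [key (ε / (4 * Real.exp 2)) (by positivity)] with n hn
  rw [Real.dist_0_eq_abs, abs_of_nonneg (hP n)]
  have : Real.exp 2 * (2 * (ε / (4 * Real.exp 2))) = ε / 2 := by field_simp; norm_num
  linarith

lemma aux_subdiff {F : H → EReal} (hF : ProperLscConvexE F) {x p : H} (hp : p ∈ ESubdiff F x) :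
    F x ≠ ⊤ ∧ ∀ y, F y ≠ ⊤ → (F x).toReal + ⟪p, y - x⟫ ≤ (F y).toReal := by
  have hx : F x ≠ ⊤ := by
    intro h
    obtain ⟨y, hy⟩ := hF.1
    have := hp y
    rw [h, EReal.top_add_coe] at this
    exact hy (top_le_iff.1 this)
  refine ⟨hx, fun y hy => ?_⟩
  have := hp y
  rw [← EReal.coe_toReal hx (hF.2.1 x), ← EReal.coe_toReal hy (hF.2.1 y)] at this
  exact_mod_cast this

/-- Sublevel sets of the sum of a continuous convex function and a proper lsc convex one are
weakly sequentially closed. -/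
lemma aux_weak_lsc {f : H → ℝ} {F : H → EReal} (hf : Continuous f) (hc : ConvexOn ℝ Set.univ f)
    (hF : ProperLscConvexE F) {x : ℕ → H} {p : H} (hx : WeakConv x p) (c : ℝ)
    (h : ∀ᶠ n in atTop, F (x n) ≤ ((c - f (x n) : ℝ) : EReal)) :
    F p ≤ ((c - f p : ℝ) : EReal) := by
  set s : Set H := {y | F y ≤ ((c - f y : ℝ) : EReal)} with hs
  have hcl : IsClosed s := by
    have h1 := hF.2.2.1.isClosed_epigraph
    have h2 : Continuous (fun y : H => (y, ((c - f y : ℝ) : EReal))) :=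
      continuous_id.prodMk (continuous_coe_real_ereal.comp (continuous_const.sub hf))
    exact h1.preimage h2
  have hcv : Convex ℝ s := by
    intro a ha b hb t t' ht ht' htt'
    obtain rfl : t' = 1 - t := by linarith
    have h1 := hF.2.2.2 a b t ht (by linarith)
    have h2 : ((t : ℝ) : EReal) * F a ≤ ((t * (c - f a) : ℝ) : EReal) := by
      rw [EReal.coe_mul]
      exact mul_le_mul_of_nonneg_left ha (by exact_mod_cast ht)
    have h3 : (((1 - t : ℝ)) : EReal) * F b ≤ (((1 - t) * (c - f b) : ℝ) : EReal) := by
      rw [EReal.coe_mul]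
      exact mul_le_mul_of_nonneg_left hb (by exact_mod_cast ht')
    have h4 := hc.2 (Set.mem_univ a) (Set.mem_univ b) ht ht' (by ring)
    show F _ ≤ _
    refine le_trans h1 (le_trans (add_le_add h2 h3) ?_)
    rw [← EReal.coe_add, EReal.coe_le_coe_iff]
    simp only [smul_eq_mul] at h4
    linarith
  show p ∈ s
  by_contra hps
  obtain ⟨g, u, h1, h2⟩ := geometric_hahn_banach_point_closed hcv hcl hps
  have h3 := hx ((InnerProductSpace.toDual ℝ H).symm g)
  have e : ∀ y, ⟪y, (InnerProductSpace.toDual ℝ H).symm g⟫ = g y := by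
    intro y
    rw [real_inner_comm, InnerProductSpace.toDual_symm_apply]
  simp only [e] at h3
  have h4 : u ≤ g p := ge_of_tendsto h3 (by filter_upwards [h] with n hn; exact (h2 _ hn).le)
  linarith

/-- The summability condition in real terms. -/
lemma aux_key (d : SFBP H) {z u : H} (hz : z ∈ nCone d.C u) :
    ∃ ρ : ℕ → ℝ, (∀ n, 0 ≤ ρ n) ∧ (Summable fun n => d.lam n * ρ n) ∧
      ∀ n y, d.Ψ₂ y ≠ ⊤ →
        ⟪z, y - u⟫ - d.beta n * (d.Ψ₁ y + (d.Ψ₂ y).toReal) ≤ ρ n := by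
  obtain ⟨M, hM⟩ := d.keyCond z ⟨u, hz⟩
  set D : ℕ → EReal := fun n =>
    (fenchelConj (fun q => ((d.Ψ₁ q : ℝ) : EReal) + d.Ψ₂ q) ((d.beta n)⁻¹ • z)
          - suppFun d.C ((d.beta n)⁻¹ • z)) with hD
  have hbinv : ∀ n, 0 < (d.beta n)⁻¹ := fun n => inv_pos.2 (d.betaPos n)
  have hsupp : ∀ n, suppFun d.C ((d.beta n)⁻¹ • z) = ((⟪(d.beta n)⁻¹ • z, u⟫ : ℝ) : EReal) := by
    intro n
    apply le_antisymm
    · refine iSup_le fun c => ?_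
      rw [EReal.coe_le_coe_iff]
      have h1 := hz.2 c c.2
      rw [inner_sub_right] at h1
      rw [real_inner_smul_left, real_inner_smul_left]
      exact mul_le_mul_of_nonneg_left (by linarith) (hbinv n).le
    · exact le_iSup (fun c : d.C => ((⟪(d.beta n)⁻¹ • z, (c : H)⟫ : ℝ) : EReal)) ⟨u, hz.1⟩
  have hlow : ∀ n y, d.Ψ₂ y ≠ ⊤ →
      (((d.beta n)⁻¹ * ⟪z, y - u⟫ - (d.Ψ₁ y + (d.Ψ₂ y).toReal) : ℝ) : EReal) ≤ D n := by
    intro n y hy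
    have h1 : ((⟪y, (d.beta n)⁻¹ • z⟫ : ℝ) : EReal) - (((d.Ψ₁ y : ℝ) : EReal) + d.Ψ₂ y) ≤
        fenchelConj (fun q => ((d.Ψ₁ q : ℝ) : EReal) + d.Ψ₂ q) ((d.beta n)⁻¹ • z) :=
      le_iSup (fun y => ((⟪y, (d.beta n)⁻¹ • z⟫ : ℝ) : EReal) - (((d.Ψ₁ y : ℝ) : EReal) + d.Ψ₂ y)) y
    have h2 : (((d.beta n)⁻¹ * ⟪z, y - u⟫ - (d.Ψ₁ y + (d.Ψ₂ y).toReal) : ℝ) : EReal) =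
        ((⟪y, (d.beta n)⁻¹ • z⟫ : ℝ) : EReal) - (((d.Ψ₁ y : ℝ) : EReal) + d.Ψ₂ y)
        - ((⟪(d.beta n)⁻¹ • z, u⟫ : ℝ) : EReal) := by
      have h3 := EReal.coe_toReal hy (d.properΨ₂.2.1 y)
      conv_rhs => rw [← h3]
      rw [← EReal.coe_add, ← EReal.coe_sub, ← EReal.coe_sub, EReal.coe_eq_coe_iff]
      rw [real_inner_smul_left, real_inner_smul_right, inner_sub_right, real_inner_comm z y]
      ring
    rw [h2, hD]
    simp only [hsupp n]
    exact EReal.sub_le_sub h1 le_rfl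
  have huC := hz.1
  rw [d.Cdef] at huC
  have hu1 : d.Ψ₁ u = 0 := by
    obtain ⟨p, hp⟩ := d.minΨ₁
    exact le_antisymm (hp ▸ huC.1 p) (d.Ψ₁nonneg u)
  have hu2 : d.Ψ₂ u = 0 := by
    obtain ⟨p, hp⟩ := d.minΨ₂
    exact le_antisymm (hp ▸ huC.2 p) (d.Ψ₂nonneg u)
  have hD0 : ∀ n, 0 ≤ D n := by
    intro n
    have := hlow n u (by rw [hu2]; exact EReal.zero_ne_top)
    simpa [hu1, hu2] using this
  have hlb : ∀ n, 0 < d.lam n * d.beta n := fun n => mul_pos (d.lamPos n) (d.betaPos n)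
  have hterm : ∀ n, 0 ≤ ((d.lam n * d.beta n : ℝ) : EReal) * D n := fun n =>
    mul_nonneg (by exact_mod_cast (hlb n).le) (hD0 n)
  have hDtop : ∀ n, D n ≠ ⊤ := by
    intro n hn
    have h1 := hM (n + 1)
    have h2 : ((d.lam n * d.beta n : ℝ) : EReal) * D n ≤ (M : EReal) :=
      le_trans (Finset.single_le_sum (f := fun n => ((d.lam n * d.beta n : ℝ) : EReal) * D n)
        (fun i _ => hterm i) (Finset.self_mem_range_succ n)) h1
    rw [hn, EReal.coe_mul_top_of_pos (hlb n)] at h2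
    exact absurd (top_le_iff.1 h2) (EReal.coe_ne_top M)
  have hDbot : ∀ n, D n ≠ ⊥ := fun n h => by
    have := hD0 n
    rw [h] at this
    simp at this
  have hDr : ∀ n, (((D n).toReal : ℝ) : EReal) = D n := fun n => EReal.coe_toReal (hDtop n) (hDbot n)
  have hDr0 : ∀ n, 0 ≤ (D n).toReal := fun n => EReal.toReal_nonneg (hD0 n)
  refine ⟨fun n => d.beta n * (D n).toReal, fun n => mul_nonneg (d.betaPos n).le (hDr0 n), ?_, ?_⟩
  · refine summable_of_sum_range_le (c := M) (fun n => mul_nonneg (d.lamPos n).le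
      (mul_nonneg (d.betaPos n).le (hDr0 n))) ?_
    intro N
    have h1 := hM N
    have h2 : ((∑ n ∈ Finset.range N, d.lam n * (d.beta n * (D n).toReal) : ℝ) : EReal) ≤ (M : EReal) := by
      refine le_trans (le_of_eq ?_) h1
      have : ∀ g : ℕ → ℝ, ((∑ n ∈ Finset.range N, g n : ℝ) : EReal) =
          ∑ n ∈ Finset.range N, ((g n : ℝ) : EReal) := by
        intro g
        induction N with
        | zero => simp
        | succ N ih =>
          rw [Finset.sum_range_succ, Finset.sum_range_succ, EReal.coe_add, ih (hM N)]
      rw [this]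
      refine Finset.sum_congr rfl fun n _ => ?_
      rw [← mul_assoc, EReal.coe_mul, hDr]
    exact_mod_cast h2
  · intro n y hy
    have h1 := hlow n y hy
    rw [← hDr n, EReal.coe_le_coe_iff] at h1
    have h2 := mul_le_mul_of_nonneg_left h1 (d.betaPos n).le
    rw [mul_sub, ← mul_assoc, mul_inv_cancel₀ (d.betaPos n).ne', one_mul] at h2
    exact h2

lemma aux_telescope {A b e : ℕ → ℝ} (hA : ∀ n, 0 ≤ A n) (hb : ∀ n, 0 ≤ b n)
    (he : ∀ n, 0 ≤ e n) (hse : Summable e)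
    (h : ∀ᶠ n in atTop, b n ≤ A n - A (n + 1) + e n) : Summable b := by
  obtain ⟨N, hN⟩ := eventually_atTop.1 h
  rw [← summable_nat_add_iff N]
  refine summable_of_sum_range_le (c := A N + ∑' n, e (n + N)) (fun n => hb _) ?_
  intro m
  have h1 : ∑ i ∈ Finset.range m, b (i + N) ≤ A N - A (m + N) + ∑ i ∈ Finset.range m, e (i + N) := by
    induction m with
    | zero => simp
    | succ m ih =>
      rw [Finset.sum_range_succ, Finset.sum_range_succ]
      have := hN (m + N) (Nat.le_add_left _ _)
      rw [show m + 1 + N = m + N + 1 by ring]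
      linarith
  have h2 := Summable.sum_le_tsum (f := fun i => e (i + N)) (Finset.range m) (fun i _ => he _)
    ((summable_nat_add_iff N).2 hse)
  have := hA (m + N)
  linarith

/-- One forward-backward step: comparison with an arbitrary point `q`. -/
lemma aux_step (d : SFBP H) {Φ₂ : H → EReal} (hΦ₂ : ProperLscConvexE Φ₂) {n : ℕ} {a w : H}
    (ha : a ∈ ESubdiff Φ₂ (d.x (n + 1))) (hw : w ∈ ESubdiff d.Ψ₂ (d.x (n + 1)))
    (halg : d.x n - d.x (n + 1) =
      d.lam n • (d.Φ' (d.x n) + d.beta n • d.Ψ₁' (d.x n) + a + d.beta n • w))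
    (q : H) (hq : Φ₂ q ≠ ⊤) (hq' : d.Ψ₂ q ≠ ⊤) :
    2 * d.lam n * ((d.Φ (d.x (n + 1)) + (Φ₂ (d.x (n + 1))).toReal +
        d.beta n * (d.Ψ₁ (d.x (n + 1)) + (d.Ψ₂ (d.x (n + 1))).toReal)) -
      (d.Φ q + (Φ₂ q).toReal + d.beta n * (d.Ψ₁ q + (d.Ψ₂ q).toReal))) ≤
    ‖d.x n - q‖ ^ 2 - ‖d.x (n + 1) - q‖ ^ 2 +
      (d.lam n * d.LΦ + d.LΨ₁ * (d.lam n * d.beta n) - 1) * ‖d.x (n + 1) - d.x n‖ ^ 2 := by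
  set x := d.x n
  set y := d.x (n + 1)
  have h1 := (aux_subdiff hΦ₂ ha).2 q hq
  have h2 := (aux_subdiff d.properΨ₂ hw).2 q hq'
  have h3 := aux_descent d.gradΦ d.lipΦ x y
  have h4 := aux_grad_ineq d.convΦ d.gradΦ x q
  have h5 := aux_descent d.gradΨ₁ d.lipΨ₁ x y
  have h6 := aux_grad_ineq d.convΨ₁ d.gradΨ₁ x q
  have e : ∀ r : H, ⟪r, q - x⟫ = ⟪r, q - y⟫ + ⟪r, y - x⟫ := by
    intro r; rw [← inner_add_right]; congr 1; abel
  rw [e] at h4 h6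
  have h7 : ⟪x - y, q - y⟫ = d.lam n * (⟪d.Φ' x, q - y⟫ + d.beta n * ⟪d.Ψ₁' x, q - y⟫
      + ⟪a, q - y⟫ + d.beta n * ⟪w, q - y⟫) := by
    rw [halg]
    simp only [inner_add_left, real_inner_smul_left]
  have h8 : ‖x - q‖ ^ 2 = ‖x - y‖ ^ 2 - 2 * ⟪x - y, q - y⟫ + ‖q - y‖ ^ 2 := by
    rw [show x - q = (x - y) - (q - y) by abel, norm_sub_sq_real]
  rw [norm_sub_rev x y, norm_sub_rev q y] at h8
  have hl := d.lamPos n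
  have hb := d.betaPos n
  have hlb := mul_pos hl hb
  have k1 := mul_le_mul_of_nonneg_left (add_le_add h1 (add_le_add h3 h4)) hl.le
  have k2 := mul_le_mul_of_nonneg_left (add_le_add h2 (add_le_add h5 h6)) hlb.le
  rw [h8, h7]
  linarith

/-- Energy estimate. -/
lemma aux_energy (d : SFBP H) {Φ₂ : H → EReal} (hΦ₂ : ProperLscConvexE Φ₂) {n : ℕ} {a w : H}
    (ha : a ∈ ESubdiff Φ₂ (d.x (n + 1))) (hw : w ∈ ESubdiff d.Ψ₂ (d.x (n + 1)))
    (halg : d.x n - d.x (n + 1) =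
      d.lam n • (d.Φ' (d.x n) + d.beta n • d.Ψ₁' (d.x n) + a + d.beta n • w))
    {u v p : H} (hv : v ∈ ESubdiff Φ₂ u) (hu1 : d.Ψ₁ u = 0) (hu2 : d.Ψ₂ u = 0)
    (hvp : v + d.Φ' u + p = 0) {γ θ : ℝ} (hγ : 0 < γ) (hθ0 : 0 ≤ θ) (hθ1 : θ ≤ 1)
    (hγn : d.LΨ₁ * (d.lam n * d.beta n) ≤ γ) :
    ‖d.x (n + 1) - u‖ ^ 2 +
      (1 - (1 + θ) * γ / 2 - d.lam n * d.LΦ) * ‖d.x (n + 1) - d.x n‖ ^ 2 +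
      2 * (d.lam n * d.beta n) * θ * (d.Ψ₁ (d.x (n + 1)) + (d.Ψ₂ (d.x (n + 1))).toReal) ≤
    ‖d.x n - u‖ ^ 2 + 2 * d.lam n * ⟪p, d.x (n + 1) - u⟫ := by
  have hl := d.lamPos n
  have hb := d.betaPos n
  have hlb := mul_pos hl hb
  have hQ : 0 ≤ (d.Ψ₂ (d.x (n + 1))).toReal := EReal.toReal_nonneg (d.Ψ₂nonneg _)
  set x := d.x n
  set y := d.x (n + 1)
  obtain ⟨hut, hv'⟩ := aux_subdiff hΦ₂ hv
  obtain ⟨hyt, ha'⟩ := aux_subdiff hΦ₂ ha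
  have h1 := ha' u hut
  have h1' := hv' y hyt
  have h2 := (aux_subdiff d.properΨ₂ hw).2 u (by rw [hu2]; exact EReal.zero_ne_top)
  rw [hu2, EReal.toReal_zero] at h2
  have h3 := aux_descent d.gradΦ d.lipΦ x y
  have h4 := aux_grad_ineq d.convΦ d.gradΦ x u
  have h4' := aux_grad_ineq d.convΦ d.gradΦ u y
  have h5 := aux_descent d.gradΨ₁ d.lipΨ₁ x y
  have h6 := aux_grad_ineq d.convΨ₁ d.gradΨ₁ x u
  rw [hu1] at h6
  have hco := aux_coco d.convΨ₁ d.gradΨ₁ d.lipΨ₁ d.Ψ₁nonneg hu1 hlb hγ hγn x y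
  have e : ∀ r : H, ⟪r, u - x⟫ = -⟪r, y - u⟫ + ⟪r, y - x⟫ := by
    intro r; rw [← inner_neg_right, ← inner_add_right]; congr 1; abel
  have e' : ∀ r : H, ⟪r, u - y⟫ = -⟪r, y - u⟫ := by
    intro r; rw [← inner_neg_right]; congr 1; abel
  rw [e] at h4 h6
  rw [e'] at h1 h2
  have h7 : ⟪x - y, y - u⟫ = d.lam n * (⟪d.Φ' x, y - u⟫ + d.beta n * ⟪d.Ψ₁' x, y - u⟫
      + ⟪a, y - u⟫ + d.beta n * ⟪w, y - u⟫) := by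
    rw [halg]
    simp only [inner_add_left, real_inner_smul_left]
  have h8 : ‖x - u‖ ^ 2 = ‖x - y‖ ^ 2 + 2 * ⟪x - y, y - u⟫ + ‖y - u‖ ^ 2 := by
    rw [show x - u = (x - y) + (y - u) by abel, norm_add_sq_real]
  rw [norm_sub_rev x y] at h8
  have h9 : ⟪v, y - u⟫ + ⟪d.Φ' u, y - u⟫ + ⟪p, y - u⟫ = 0 := by
    rw [← inner_add_left, ← inner_add_left, hvp, inner_zero_left]
  have h10 : (d.Ψ₂ y).toReal ≤ ⟪w, y - u⟫ := by linarith
  -- the Φ part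
  have k1 : d.lam n * (-⟪p, y - u⟫ - d.LΦ / 2 * ‖y - x‖ ^ 2) ≤
      d.lam n * (⟪d.Φ' x, y - u⟫ + ⟪a, y - u⟫) :=
    mul_le_mul_of_nonneg_left (by linarith) hl.le
  -- the Ψ₂ part
  have k2 : (d.lam n * d.beta n) * (θ * (d.Ψ₂ y).toReal) ≤ (d.lam n * d.beta n) * ⟪w, y - u⟫ :=
    mul_le_mul_of_nonneg_left (by nlinarith) hlb.le
  -- the Ψ₁ part
  have k3 : 2 * (d.lam n * d.beta n) * d.Ψ₁ y - γ * ‖y - x‖ ^ 2 ≤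
      2 * (d.lam n * d.beta n) * ⟪d.Ψ₁' x, y - u⟫ := by
    have m1 := mul_le_mul_of_nonneg_left (add_le_add h5 h6) hlb.le
    have m2 := mul_le_mul_of_nonneg_right hγn (sq_nonneg ‖y - x‖)
    linarith
  have k4 := add_le_add (mul_le_mul_of_nonneg_left k3 hθ0)
    (mul_le_mul_of_nonneg_left hco (sub_nonneg.2 hθ1))
  rw [h8, h7]
  linarith

/-- **Lemma 5.14.** With `A = ∂Φ₂`, under case (i) or (ii), any weak limit of a
subsequence of `(x_n)` belongs to
`S = argmin {Φ(x) + Φ₂(x) : x ∈ argmin (Ψ₁ + Ψ₂)}`. -/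
theorem sfbp_weak_cluster_in_S (d : SFBP H) (Φ₂ : H → EReal)
    (hΦ₂ : ProperLscConvexE Φ₂) (hA : d.A = ESubdiff Φ₂)
    (hl2 : Summable fun n => (d.lam n * d.LΦ) ^ 2)
    (hcase : ((∃ ε > (0:ℝ), ∀ᶠ n in Filter.atTop, ε ≤ d.lam n * d.beta n) ∧
        (∃ B : ℝ, ∀ n, d.lam n ≤ B) ∧
        (∃ K > (0:ℝ), ∀ n, d.beta (n + 1) - d.beta n ≤ K * (d.lam (n + 1) * d.beta (n + 1)))) ∨
      ((d.Ψ₁ = fun _ => 0) ∧ (d.Ψ₂ = fun _ => 0)))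
    (xinf : H) (φ : ℕ → ℕ) (hφ : StrictMono φ) (hconv : WeakConv (d.x ∘ φ) xinf) :
    (∀ q, ((d.Ψ₁ xinf : ℝ) : EReal) + d.Ψ₂ xinf ≤ ((d.Ψ₁ q : ℝ) : EReal) + d.Ψ₂ q) ∧
    ∀ q, (∀ r, ((d.Ψ₁ q : ℝ) : EReal) + d.Ψ₂ q ≤ ((d.Ψ₁ r : ℝ) : EReal) + d.Ψ₂ r) →
      ((d.Φ xinf : ℝ) : EReal) + Φ₂ xinf ≤ ((d.Φ q : ℝ) : EReal) + Φ₂ q := by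
  obtain ⟨u, v, hv, p, hp, hvp⟩ := d.Sne
  have halgo := d.algo
  rw [hA] at hv halgo
  choose a ha w hw halg using halgo
  have huC := hp.1
  rw [d.Cdef] at huC
  have hCne : ∃ c, d.Ψ₁ c = 0 ∧ d.Ψ₂ c = 0 ∧ c = u := by
    obtain ⟨p1, hp1⟩ := d.minΨ₁
    obtain ⟨p2, hp2⟩ := d.minΨ₂
    exact ⟨u, le_antisymm (hp1 ▸ huC.1 p1) (d.Ψ₁nonneg u),
      le_antisymm (hp2 ▸ huC.2 p2) (d.Ψ₂nonneg u), rfl⟩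
  obtain ⟨_, hu1, hu2, rfl⟩ := hCne
  rename_i u
  obtain ⟨hut, hv'⟩ := aux_subdiff hΦ₂ hv
  have hut2 : d.Ψ₂ u ≠ ⊤ := by rw [hu2]; exact EReal.zero_ne_top
  have hxt : ∀ n, Φ₂ (d.x (n + 1)) ≠ ⊤ := fun n => (aux_subdiff hΦ₂ (ha n)).1
  have hxt2 : ∀ n, d.Ψ₂ (d.x (n + 1)) ≠ ⊤ := fun n => (aux_subdiff d.properΨ₂ (hw n)).1
  -- abbreviations
  set Fs : ℝ := d.Φ u + (Φ₂ u).toReal with hFs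
  set ψ : ℕ → ℝ := fun n => d.Ψ₁ (d.x n) + (d.Ψ₂ (d.x n)).toReal with hψ
  set E : ℕ → ℝ := fun n => d.Φ (d.x (n + 1)) + (Φ₂ (d.x (n + 1))).toReal
    + d.beta n * ψ (n + 1) - Fs with hE
  set P : ℕ → ℝ := fun n => max (E n) 0 with hPdef
  have hψ0 : ∀ n, 0 ≤ ψ n := fun n =>
    add_nonneg (d.Ψ₁nonneg _) (EReal.toReal_nonneg (d.Ψ₂nonneg _))
  have hP0 : ∀ n, 0 ≤ P n := fun n => le_max_right _ _
  have hEP : ∀ n, E n ≤ P n := fun n => le_max_left _ _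
  -- constants
  obtain ⟨γ0, hγ0, hγev⟩ := d.limsupCond
  set γ := max γ0 1 with hγdef
  have hγ2 : γ < 2 := max_lt hγ0 (by norm_num)
  have hγ1 : 1 ≤ γ := le_max_right _ _
  have hγpos : 0 < γ := by linarith
  set θ := (2 - γ) / (2 * γ) with hθ
  have hθpos : 0 < θ := div_pos (by linarith) (by linarith)
  have hθ1 : θ ≤ 1 := by rw [hθ, div_le_one (by linarith)]; linarith
  have hc : 1 - (1 + θ) * γ / 2 = (2 - γ) / 4 := by rw [hθ]; field_simp; ring
  set c1 := (2 - γ) / 8 with hc1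
  have hc1pos : 0 < c1 := by rw [hc1]; linarith
  -- normal cone scaling
  have hscale : ∀ s : ℝ, 0 ≤ s → s • p ∈ nCone d.C u := by
    intro s hs
    refine ⟨hp.1, fun c hc => ?_⟩
    rw [real_inner_smul_left]
    exact mul_nonpos_of_nonneg_of_nonpos hs (hp.2 c hc)
  obtain ⟨ρ1, hρ1, hsρ1, hkρ1⟩ := aux_key d hp
  obtain ⟨ρ2, hρ2, hsρ2, hkρ2⟩ := aux_key d (hscale (2 / θ) (by positivity))
  obtain ⟨ρ3, hρ3, hsρ3, hkρ3⟩ := aux_key d (hscale 4 (by norm_num))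
  -- lam * L → 0
  have hlL : Tendsto (fun n => d.lam n * d.LΦ) atTop (𝓝 0) := by
    have h1 := hl2.tendsto_atTop_zero
    have h2 := h1.sqrt
    simp only [Real.sqrt_sq_eq_abs, Real.sqrt_zero] at h2
    exact (tendsto_zero_iff_abs_tendsto_zero _).2 h2
  have hlLev : ∀ᶠ n in atTop, d.lam n * d.LΦ ≤ c1 :=
    (hlL.eventually_lt_const hc1pos).mono fun n h => h.le
  have hγev' : ∀ᶠ n in atTop, d.LΨ₁ * (d.lam n * d.beta n) ≤ γ :=
    hγev.mono fun n h => h.trans (le_max_left _ _)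
  -- lower bound on E
  have hElow : ∀ n, -⟪p, d.x (n + 1) - u⟫ + d.beta n * ψ (n + 1) ≤ E n := by
    intro n
    have h1 := hv' _ (hxt n)
    have h2 := aux_grad_ineq d.convΦ d.gradΦ u (d.x (n + 1))
    have h9 : ⟪v, d.x (n + 1) - u⟫ + ⟪d.Φ' u, d.x (n + 1) - u⟫ + ⟪p, d.x (n + 1) - u⟫ = 0 := by
      rw [← inner_add_left, ← inner_add_left, hvp, inner_zero_left]
    simp only [hE, hFs]
    linarith
  have hEρ : ∀ n, -ρ1 n ≤ E n := by
    intro n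
    have h1 := hElow n
    have h2 := hkρ1 n (d.x (n + 1)) (hxt2 n)
    simp only [hψ] at h1
    linarith
  -- energy
  have hen : ∀ᶠ n in atTop, c1 * ‖d.x (n + 1) - d.x n‖ ^ 2 +
      θ * ((d.lam n * d.beta n) * ψ (n + 1)) ≤
      ‖d.x n - u‖ ^ 2 - ‖d.x (n + 1) - u‖ ^ 2 + θ * (d.lam n * ρ2 n) := by
    filter_upwards [hlLev, hγev'] with n h1 h2
    have h3 := aux_energy d hΦ₂ (ha n) (hw n) (halg n) hv hu1 hu2 hvp hγpos hθpos.le hθ1 h2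
    have h4 := hkρ2 n (d.x (n + 1)) (hxt2 n)
    rw [real_inner_smul_left] at h4
    have h5 := mul_le_mul_of_nonneg_left h4 (mul_nonneg hθpos.le (d.lamPos n).le)
    rw [hc] at h3
    have h6 := mul_le_mul_of_nonneg_right h1 (sq_nonneg ‖d.x (n + 1) - d.x n‖)
    have h7 : θ * d.lam n * (2 / θ * ⟪p, d.x (n + 1) - u⟫ -
        d.beta n * (d.Ψ₁ (d.x (n + 1)) + (d.Ψ₂ (d.x (n + 1))).toReal)) =
        2 * d.lam n * ⟪p, d.x (n + 1) - u⟫ - θ * ((d.lam n * d.beta n) * ψ (n + 1)) := by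
      simp only [hψ]
      field_simp
    rw [h7] at h5
    simp only [hψ] at h5 ⊢
    have h8 : (2 - γ) / 4 = 2 * c1 := by rw [hc1]; ring
    rw [h8] at h3
    linarith
  have hsum0 : Summable fun n => c1 * ‖d.x (n + 1) - d.x n‖ ^ 2 +
      θ * ((d.lam n * d.beta n) * ψ (n + 1)) := by
    refine aux_telescope (A := fun n => ‖d.x n - u‖ ^ 2) (e := fun n => θ * (d.lam n * ρ2 n))
      (fun n => sq_nonneg _) (fun n => ?_) (fun n => ?_) (hsρ2.mul_left _) hen
    · have := hψ0 (n + 1)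
      have := d.lamPos n
      have := d.betaPos n
      positivity
    · exact mul_nonneg hθpos.le (mul_nonneg (d.lamPos n).le (hρ2 n))
  have hτψ0 : ∀ n, 0 ≤ (d.lam n * d.beta n) * ψ (n + 1) := fun n =>
    mul_nonneg (mul_pos (d.lamPos n) (d.betaPos n)).le (hψ0 _)
  have hsd : Summable fun n => ‖d.x (n + 1) - d.x n‖ ^ 2 := by
    have : Summable fun n => c1 * ‖d.x (n + 1) - d.x n‖ ^ 2 := by
      refine Summable.of_nonneg_of_le (fun n => by positivity) (fun n => ?_) hsum0
      have := mul_nonneg hθpos.le (hτψ0 n)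
      linarith
    exact (summable_mul_left_iff hc1pos.ne').1 this
  have hsψ : Summable fun n => (d.lam n * d.beta n) * ψ (n + 1) := by
    have : Summable fun n => θ * ((d.lam n * d.beta n) * ψ (n + 1)) := by
      refine Summable.of_nonneg_of_le (fun n => mul_nonneg hθpos.le (hτψ0 n)) (fun n => ?_) hsum0
      have : 0 ≤ c1 * ‖d.x (n + 1) - d.x n‖ ^ 2 := by positivity
      linarith
    exact (summable_mul_left_iff hθpos.ne').1 this
  -- summability of lam * P
  have hsP : Summable fun n => d.lam n * P n := by
    have : Summable fun n => 2 * (d.lam n * P n) := by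
      refine aux_telescope (A := fun n => ‖d.x n - u‖ ^ 2)
        (e := fun n => 2 * ‖d.x (n + 1) - d.x n‖ ^ 2 + 2 * (d.lam n * ρ1 n))
        (fun n => sq_nonneg _)
        (fun n => mul_nonneg (by norm_num) (mul_nonneg (d.lamPos n).le (hP0 n)))
        (fun n => ?_) ((hsd.mul_left 2).add (hsρ1.mul_left 2)) ?_
      · have := mul_nonneg (d.lamPos n).le (hρ1 n)
        positivity
      · filter_upwards [hlLev, hγev'] with n h1 h2
        have h3 := aux_step d hΦ₂ (ha n) (hw n) (halg n) u hut hut2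
        rw [hu1, hu2, EReal.toReal_zero] at h3
        have h4 : P n ≤ E n + ρ1 n := max_le (by linarith [hρ1 n]) (by linarith [hEρ n])
        have h5 := mul_le_mul_of_nonneg_left h4 (d.lamPos n).le
        have h6 : (d.lam n * d.LΦ + d.LΨ₁ * (d.lam n * d.beta n) - 1) *
            ‖d.x (n + 1) - d.x n‖ ^ 2 ≤ 2 * ‖d.x (n + 1) - d.x n‖ ^ 2 :=
          mul_le_mul_of_nonneg_right (by rw [hc1] at h1; linarith) (sq_nonneg _)
        simp only [hE, hψ, hFs] at h5
        linarith
    exact (summable_mul_left_iff two_ne_zero).1 this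
  -- descent
  have hdesc : ∀ᶠ n in atTop, E (n + 1) ≤ E n + (d.beta (n + 1) - d.beta n) * ψ (n + 1) := by
    filter_upwards [(tendsto_add_atTop_nat 1).eventually hlLev,
      (tendsto_add_atTop_nat 1).eventually hγev,
      (tendsto_add_atTop_nat 1).eventually
        (hlL.eventually_lt_const (show 0 < 2 - γ by linarith))] with n h1 h2 h2'
    have h3 := aux_step d hΦ₂ (ha (n + 1)) (hw (n + 1)) (halg (n + 1)) (d.x (n + 1))
      (hxt n) (hxt2 n)
    rw [sub_self, norm_zero] at h3
    have h4 : (d.lam (n + 1) * d.LΦ + d.LΨ₁ * (d.lam (n + 1) * d.beta (n + 1)) - 1) *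
            ‖d.x (n + 1 + 1) - d.x (n + 1)‖ ^ 2 ≤ 1 * ‖d.x (n + 1 + 1) - d.x (n + 1)‖ ^ 2 :=
      mul_le_mul_of_nonneg_right (by linarith [le_max_left γ0 1]) (sq_nonneg _)
    have h5 : 2 * d.lam (n + 1) * (E (n + 1) - (E n + (d.beta (n + 1) - d.beta n) * ψ (n + 1))) ≤ 0 := by
      simp only [hE, hψ, hFs]
      linarith
    have h6 : 0 < 2 * d.lam (n + 1) := by linarith [d.lamPos (n + 1)]
    have := nonpos_of_mul_nonpos_right h5 h6
    linarith
  -- recursion and ψ → 0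
  have hrec : ∃ K > (0:ℝ), ∀ᶠ n in atTop, 2 * K * d.lam (n + 1) ≤ 1 →
      P (n + 1) ≤ (1 + 4 * K * d.lam (n + 1)) * P n + K * d.lam (n + 1) * ρ3 (n + 1) := by
    have htriv : ∀ K > (0:ℝ), ∀ n, E (n + 1) ≤ E n →
        P (n + 1) ≤ (1 + 4 * K * d.lam (n + 1)) * P n + K * d.lam (n + 1) * ρ3 (n + 1) := by
      intro K hK n hn
      have h1 := hP0 n
      have h2 := hρ3 (n + 1)
      have h3 := d.lamPos (n + 1)
      have h4 : 0 ≤ 4 * K * d.lam (n + 1) * P n := by positivity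
      have h5 : 0 ≤ K * d.lam (n + 1) * ρ3 (n + 1) := by positivity
      have h6 := hEP n
      exact max_le (by linarith) (by linarith)
    rcases hcase with ⟨_, _, K, hK, hβ⟩ | ⟨hΨ1, hΨ2⟩
    · refine ⟨K, hK, ?_⟩
      filter_upwards [hdesc] with n hn hKn
      by_cases hb : d.beta (n + 1) ≤ d.beta n
      · refine htriv K hK n ?_
        have := mul_nonneg (sub_nonneg.2 hb) (hψ0 (n + 1))
        linarith
      · have hl := d.lamPos (n + 1)
        have hb' := d.betaPos (n + 1)
        have h1 := hkρ3 (n + 1) (d.x (n + 1)) (hxt2 n)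
        rw [real_inner_smul_left] at h1
        have h2 := hElow n
        have h3 := hβ n
        have h4 : d.beta (n + 1) ≤ 2 * d.beta n := by nlinarith
        have h5 := mul_le_mul_of_nonneg_right h4 (hψ0 (n + 1))
        have h6 : d.beta (n + 1) * ψ (n + 1) ≤ 4 * E n + ρ3 (n + 1) := by
          simp only [hψ] at h1 h2 h5 ⊢
          linarith
        have h7 := mul_le_mul_of_nonneg_right h3 (hψ0 (n + 1))
        have hKl : 0 ≤ K * d.lam (n + 1) := by positivity
        have h8 := mul_le_mul_of_nonneg_left h6 hKl
        have h9 : E (n + 1) ≤ (1 + 4 * K * d.lam (n + 1)) * E n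
            + K * d.lam (n + 1) * ρ3 (n + 1) := by linarith
        have h10 : (1 + 4 * K * d.lam (n + 1)) * E n ≤ (1 + 4 * K * d.lam (n + 1)) * P n :=
          mul_le_mul_of_nonneg_left (hEP n) (by linarith)
        refine max_le (by linarith) ?_
        have := hP0 n
        have := hρ3 (n + 1)
        positivity
    · refine ⟨1, one_pos, ?_⟩
      filter_upwards [hdesc] with n hn _
      refine htriv 1 one_pos n ?_
      have : ψ (n + 1) = 0 := by simp [hψ, hΨ1, hΨ2]
      rw [this] at hn
      linarith
  obtain ⟨K, hK, hrec⟩ := hrec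
  have hPlim := aux_gronwall hK d.lamPos d.lamDiv hP0 hρ3 hsP hsρ3 hrec
  have hψlim : Tendsto (fun n => ψ (n + 1)) atTop (𝓝 0) := by
    rcases hcase with ⟨⟨ε, hε, hev⟩, _⟩ | ⟨hΨ1, hΨ2⟩
    · have h1 := (hsψ.tendsto_atTop_zero).const_mul ε⁻¹
      rw [mul_zero] at h1
      refine squeeze_zero' (Eventually.of_forall fun n => hψ0 _) ?_ h1
      filter_upwards [hev] with n hn
      rw [inv_mul_eq_div, le_div_iff₀ hε, mul_comm]
      exact mul_le_mul_of_nonneg_right hn (hψ0 _)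
    · have : ∀ n, ψ n = 0 := fun n => by simp [hψ, hΨ1, hΨ2]
      simp [this]
  -- conclusion
  have hcontΦ : Continuous d.Φ := continuous_iff_continuousAt.2 fun y =>
    (d.gradΦ y).hasFDerivAt.continuousAt
  have hcontΨ : Continuous d.Ψ₁ := continuous_iff_continuousAt.2 fun y =>
    (d.gradΨ₁ y).hasFDerivAt.continuousAt
  have hev : ∀ {Q : ℕ → Prop}, (∀ᶠ n in atTop, Q (n + 1)) → ∀ᶠ k in atTop, Q (φ k) := by
    intro Q hQ
    obtain ⟨N, hN⟩ := eventually_atTop.1 hQ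
    refine hφ.tendsto_atTop.eventually (eventually_atTop.2 ⟨N + 1, fun n hn => ?_⟩)
    have := hN (n - 1) (by omega)
    rwa [Nat.sub_add_cancel (by omega)] at this
  have hΨδ : ∀ δ > (0:ℝ), d.Ψ₂ xinf ≤ ((δ - d.Ψ₁ xinf : ℝ) : EReal) := by
    intro δ hδ
    refine aux_weak_lsc hcontΨ d.convΨ₁ d.properΨ₂ hconv δ
      (hev (Q := fun n => d.Ψ₂ (d.x n) ≤ ((δ - d.Ψ₁ (d.x n) : ℝ) : EReal)) ?_)
    filter_upwards [hψlim.eventually_lt_const hδ] with n hn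
    rw [← EReal.coe_toReal (hxt2 n) (d.properΨ₂.2.1 _), EReal.coe_le_coe_iff]
    simp only [hψ] at hn
    linarith
  have hΦδ : ∀ δ > (0:ℝ), Φ₂ xinf ≤ ((Fs + δ - d.Φ xinf : ℝ) : EReal) := by
    intro δ hδ
    refine aux_weak_lsc hcontΦ d.convΦ hΦ₂ hconv (Fs + δ)
      (hev (Q := fun n => Φ₂ (d.x n) ≤ ((Fs + δ - d.Φ (d.x n) : ℝ) : EReal)) ?_)
    filter_upwards [hPlim.eventually_lt_const hδ] with n hn
    rw [← EReal.coe_toReal (hxt n) (hΦ₂.2.1 _), EReal.coe_le_coe_iff]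
    have h1 := hEP n
    have h2 := mul_nonneg (d.betaPos n).le (hψ0 (n + 1))
    simp only [hE] at h1
    linarith
  have htop : ∀ {r : ℝ} {z : EReal}, z ≤ (r : EReal) → z ≠ ⊤ := by
    intro r z h hz
    rw [hz] at h
    exact EReal.coe_ne_top r (top_le_iff.1 h)
  have hxi2 : d.Ψ₂ xinf = (((d.Ψ₂ xinf).toReal : ℝ) : EReal) :=
    (EReal.coe_toReal (htop (hΨδ 1 one_pos)) (d.properΨ₂.2.1 _)).symm
  have hxi : Φ₂ xinf = (((Φ₂ xinf).toReal : ℝ) : EReal) :=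
    (EReal.coe_toReal (htop (hΦδ 1 one_pos)) (hΦ₂.2.1 _)).symm
  constructor
  · intro q
    have h1 : d.Ψ₁ xinf + (d.Ψ₂ xinf).toReal ≤ 0 := by
      refine le_of_forall_pos_le_add fun δ hδ => ?_
      have := hΨδ δ hδ
      rw [hxi2, EReal.coe_le_coe_iff] at this
      linarith
    refine le_trans (b := (0 : EReal)) ?_ (add_nonneg (by exact_mod_cast d.Ψ₁nonneg q) (d.Ψ₂nonneg q))
    rw [hxi2]
    exact_mod_cast h1
  · intro q hq
    have h1 : d.Φ xinf + (Φ₂ xinf).toReal ≤ Fs := by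
      refine le_of_forall_pos_le_add fun δ hδ => ?_
      have := hΦδ δ hδ
      rw [hxi, EReal.coe_le_coe_iff] at this
      linarith
    have hqC : q ∈ d.C := by
      have h2 := hq u
      rw [hu1, hu2] at h2
      simp only [EReal.coe_zero, add_zero] at h2
      have hq1 : ((d.Ψ₁ q : ℝ) : EReal) ≤ 0 :=
        le_trans (le_add_of_nonneg_right (d.Ψ₂nonneg q)) h2
      have hq2 : d.Ψ₂ q ≤ 0 :=
        le_trans (le_add_of_nonneg_left (by exact_mod_cast d.Ψ₁nonneg q)) h2
      rw [d.Cdef]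
      refine ⟨fun r => ?_, fun r => hq2.trans (d.Ψ₂nonneg r)⟩
      have : d.Ψ₁ q ≤ 0 := by exact_mod_cast hq1
      exact this.trans (d.Ψ₁nonneg r)
    by_cases hqt : Φ₂ q = ⊤
    · rw [hqt, EReal.coe_add_top]; exact le_top
    · have h3 := hv' q hqt
      have h4 := aux_grad_ineq d.convΦ d.gradΦ u q
      have h5 := hp.2 q hqC
      have h9 : ⟪v, q - u⟫ + ⟪d.Φ' u, q - u⟫ + ⟪p, q - u⟫ = 0 := by
        rw [← inner_add_left, ← inner_add_left, hvp, inner_zero_left]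
      rw [hxi, ← EReal.coe_toReal hqt (hΦ₂.2.1 q), ← EReal.coe_add, ← EReal.coe_add,
        EReal.coe_le_coe_iff]
      linarith
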